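/- Let H be a discrete ω-dimensional poc-set, let Π be the almost-equality class of principal ultrafilters, and let Σ be an almost-equality class of H°. Then: (i) for every principal ultrafilter π ∈ Π, every σ ∈ Σ, and every α ∈ H°, the almost-equality class Σ₁ of med(π,σ,α) satisfies Σ₁ ≤ Σ (that is, Σ ⊆ cl(Σ₁)); and (ii) conversely, for every almost-equality class Σ₁ with Σ₁ ≤ Σ and every σ₁ ∈ Σ₁, σ ∈ Σ, π ∈ Π, the ultrafilter med(π,σ,σ₁) is almost equal to σ₁. Hence the median interval [Π,Σ] in the Roller boundary equals {Σ₁ | Σ₁ ≤ Σ}. -/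

import Mathlib

universe u

/-- A poc-set: a partially ordered set with minimum `zero` and an order-reversing
involution `star` such that `h ≤ star h` implies `h = zero`. -/
structure PocSet (H : Type u) [PartialOrder H] : Type u where
  star : H → H
  zero : H
  zero_le : ∀ h : H, zero ≤ h
  star_star : ∀ h : H, star (star h) = h
  star_antitone : ∀ a b : H, a ≤ b → star b ≤ star a
  eq_zero_of_le_star : ∀ h : H, h ≤ star h → h = zero

namespace PocSet

variable {H : Type u} [PartialOrder H]

/-- An element is proper if it is neither `0` nor `0*`. -/
def Proper (P : PocSet H) (h : H) : Prop := h ≠ P.zero ∧ h ≠ P.star P.zero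

/-- A poc-set is discrete if every interval between proper elements is finite. -/
def IsDiscrete (P : PocSet H) : Prop :=
  ∀ a b : H, P.Proper a → P.Proper b → (Set.Icc a b).Finite

/-- Two elements are transverse if none of the four nesting relations holds. -/
def Transverse (P : PocSet H) (a b : H) : Prop :=
  ¬ a ≤ b ∧ ¬ P.star a ≤ b ∧ ¬ a ≤ P.star b ∧ ¬ P.star a ≤ P.star b

/-- ω-dimensionality: no infinite subset of pairwise transverse elements. -/
def OmegaDimensional (P : PocSet H) : Prop :=
  ∀ S : Set H, S.Pairwise P.Transverse → S.Finite

/-- Ultrafilter on a poc-set: (UF1) exactly one of `h`, `h*` belongs;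
(UF2) no `h ≤ k*` for members `h, k`. -/
def IsUltra (P : PocSet H) (α : Set H) : Prop :=
  (∀ h : H, h ∈ α ↔ P.star h ∉ α) ∧ ∀ h ∈ α, ∀ k ∈ α, ¬ h ≤ P.star k

/-- An infinite strictly descending chain of elements of `ξ`. -/
def DescChainIn (ξ : Set H) (c : ℕ → H) : Prop :=
  (∀ n, c n ∈ ξ) ∧ ∀ n, c (n + 1) < c n

/-- Principal ultrafilter: an ultrafilter with no infinite strictly descending chain. -/
def IsPrincipal (P : PocSet H) (α : Set H) : Prop :=
  P.IsUltra α ∧ ¬ ∃ c : ℕ → H, DescChainIn α c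

/-- The set of minimal elements of `α`. -/
def minset (α : Set H) : Set H := {a ∈ α | ∀ b ∈ α, b ≤ a → b = a}

/-- Almost equality: both differences are finite. -/
def AlmostEq (α β : Set H) : Prop := (α \ β).Finite ∧ (β \ α).Finite

/-- `Sg` is an almost-equality class of ultrafilters on `P`. -/
def IsAEClass (P : PocSet H) (Sg : Set (Set H)) : Prop :=
  ∃ α : Set H, P.IsUltra α ∧ Sg = {β | P.IsUltra β ∧ AlmostEq α β}

-- The Tychonoff topology on subsets of `H`, induced from the product topology
-- on `H → Bool` (with `Bool` discrete) via characteristic functions.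
open Classical in
noncomputable def tychonoff (H : Type u) : TopologicalSpace (Set H) :=
  TopologicalSpace.induced (fun (α : Set H) (h : H) => decide (h ∈ α)) inferInstance

/-- The median of three subsets of `H`. -/
def med (α β γ : Set H) : Set H := (α ∩ β) ∪ (β ∩ γ) ∪ (α ∩ γ)

end PocSet

open PocSet

open PocSet

namespace PocSet

/-- Membership in the Tychonoff closure is approximation on finite sets. -/
theorem mem_closure_tychonoff_iff {H : Type u} {S : Set (Set H)} {σ : Set H} :
    σ ∈ @closure _ (tychonoff H) S ↔ ∀ F : Finset H, ∃ τ ∈ S, ∀ h ∈ F, (h ∈ τ ↔ h ∈ σ) := by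
  classical
  unfold tychonoff
  rw [closure_induced, mem_closure_iff]
  constructor
  · intro hcl F
    obtain ⟨_, hx, τ, hτ, rfl⟩ := hcl ((F : Set H).pi fun h => {decide (h ∈ σ)})
      (isOpen_set_pi F.finite_toSet fun _ _ => isOpen_discrete _) fun _ _ => by simp
    refine ⟨τ, hτ, fun h hF => ?_⟩
    simpa using hx h hF
  · intro hF O hO hσ
    obtain ⟨I, u, hu, hsub⟩ := isOpen_pi_iff.1 hO _ hσ
    obtain ⟨τ, hτ, hag⟩ := hF I
    refine ⟨_, hsub fun h hI => ?_, τ, hτ, rfl⟩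
    have hh := (hu h hI).2
    simp only [hag h hI]
    convert hh

theorem AlmostEq.trans {H : Type u} {α β γ : Set H} (h₁ : AlmostEq α β) (h₂ : AlmostEq β γ) :
    AlmostEq α γ := by
  constructor
  · refine (h₁.1.union h₂.1).subset fun x hx => ?_
    by_cases hb : x ∈ β
    · exact Or.inr ⟨hb, hx.2⟩
    · exact Or.inl ⟨hx.1, hb⟩
  · refine (h₁.2.union h₂.2).subset fun x hx => ?_
    by_cases hb : x ∈ β
    · exact Or.inl ⟨hb, hx.2⟩
    · exact Or.inr ⟨hx.1, hb⟩

theorem AlmostEq.symm {H : Type u} {α β : Set H} (h : AlmostEq α β) : AlmostEq β α := ⟨h.2, h.1⟩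

variable {H : Type u} [PartialOrder H] {P : PocSet H}

theorem IsUltra.mem_of_le {α : Set H} (hα : P.IsUltra α) {h k : H} (hh : h ∈ α) (hk : h ≤ k) :
    k ∈ α := by
  by_contra hn
  have hs : P.star k ∈ α := by
    by_contra hs
    exact hn ((hα.1 k).2 hs)
  exact hα.2 h hh _ hs (by rwa [P.star_star])

theorem IsUltra.star_mem {α : Set H} (hα : P.IsUltra α) {h : H} (hh : h ∉ α) : P.star h ∈ α := by
  by_contra hs
  exact hh ((hα.1 h).2 hs)

theorem IsUltra.zero_notMem {α : Set H} (hα : P.IsUltra α) : P.zero ∉ α :=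
  fun h => hα.2 _ h _ h (P.zero_le _)

theorem IsUltra.star_zero_mem {α : Set H} (hα : P.IsUltra α) : P.star P.zero ∈ α :=
  hα.star_mem hα.zero_notMem

theorem star_injective (P : PocSet H) : Function.Injective P.star :=
  Function.LeftInverse.injective P.star_star

theorem star_strictAnti (P : PocSet H) : StrictAnti P.star := fun a b hab =>
  (P.star_antitone a b hab.le).lt_of_ne fun h => hab.ne' (P.star_injective h)

theorem le_star_comm {a b : H} (h : a ≤ P.star b) : b ≤ P.star a := by
  simpa only [P.star_star] using P.star_antitone _ _ h

/-- Two elements separating the same pair of ultrafilters in the same direction are comparable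
or transverse. -/
theorem transverse_of_not_le {α β : Set H} (hα : P.IsUltra α) (hβ : P.IsUltra β) {a b : H}
    (ha : a ∈ α \ β) (hb : b ∈ α \ β) (hab : ¬ a ≤ b) (hba : ¬ b ≤ a) : P.Transverse a b := by
  refine ⟨hab, fun h => ?_, hα.2 a ha.1 b hb.1, fun h => ?_⟩
  · exact hb.2 (hβ.mem_of_le (hβ.star_mem ha.2) h)
  · apply hba
    simpa only [P.star_star] using P.star_antitone _ _ h

/-- An infinite set of elements separating two ultrafilters contains an infinite monotone chain. -/
theorem exists_strictMono_or_strictAnti (homega : P.OmegaDimensional) {α β S : Set H}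
    (hα : P.IsUltra α) (hβ : P.IsUltra β) (hS : S.Infinite) (hsub : S ⊆ α \ β) :
    ∃ c : ℕ → H, (∀ n, c n ∈ S) ∧ (StrictMono c ∨ StrictAnti c) := by
  let f : ℕ ↪ S := hS.natEmbedding
  let d : ℕ → H := fun n => f n
  have hd : Function.Injective d := Subtype.val_injective.comp f.injective
  obtain ⟨g, hg⟩ := exists_increasing_or_nonincreasing_subseq (· < ·) d
  rcases hg with hg | hg
  · exact ⟨d ∘ g, fun n => (f (g n)).2, Or.inl fun m n => hg m n⟩
  obtain ⟨g', hg'⟩ := exists_increasing_or_nonincreasing_subseq (· > ·) (d ∘ g)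
  rcases hg' with hg' | hg'
  · exact ⟨(d ∘ g) ∘ g', fun n => (f (g (g' n))).2, Or.inr fun m n => hg' m n⟩
  exfalso
  have hinj : Function.Injective ((d ∘ g) ∘ g') := (hd.comp g.injective).comp g'.injective
  refine Set.infinite_range_of_injective hinj (homega _ ?_)
  have key : ∀ m n, m < n → ¬ d (g (g' m)) ≤ d (g (g' n)) ∧ ¬ d (g (g' n)) ≤ d (g (g' m)) := by
    intro m n hmn
    have hne : d (g (g' m)) ≠ d (g (g' n)) := fun h => hmn.ne (hinj h)
    exact ⟨fun h => hg _ _ (g'.strictMono hmn) (h.lt_of_ne hne),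
      fun h => hg' m n hmn (h.lt_of_ne hne.symm)⟩
  rintro _ ⟨m, rfl⟩ _ ⟨n, rfl⟩ hne
  have hmn : m ≠ n := fun h => hne (by rw [h])
  have hab : ¬ d (g (g' m)) ≤ d (g (g' n)) ∧ ¬ d (g (g' n)) ≤ d (g (g' m)) := by
    rcases hmn.lt_or_gt with h | h
    · exact key m n h
    · exact (key n m h).symm
  exact transverse_of_not_le hα hβ (hsub (f _).2) (hsub (f _).2) hab.1 hab.2

/-- An infinite set of elements separating an ultrafilter from a principal one contains an infinite
descending chain. -/
theorem exists_strictAnti (homega : P.OmegaDimensional) {α π S : Set H}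
    (hα : P.IsUltra α) (hπ : P.IsPrincipal π) (hS : S.Infinite) (hsub : S ⊆ α \ π) :
    ∃ c : ℕ → H, (∀ n, c n ∈ S) ∧ StrictAnti c := by
  obtain ⟨c, hc, hmono | hanti⟩ := exists_strictMono_or_strictAnti homega hα hπ.1 hS hsub
  · exact absurd ⟨fun n => P.star (c n), fun n => hπ.1.star_mem (hsub (hc n)).2,
      fun n => P.star_strictAnti (hmono n.lt_succ_self)⟩ hπ.2
  · exact ⟨c, hc, hanti⟩

/-- Only finitely many elements above a member of an ultrafilter separate it from a principal
ultrafilter. -/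
theorem finite_upper_diff (hdisc : P.IsDiscrete) (homega : P.OmegaDimensional) {σ π : Set H}
    (hσ : P.IsUltra σ) (hπ : P.IsPrincipal π) {f : H} (hf : f ≠ P.zero) :
    {h ∈ σ \ π | f ≤ h}.Finite := by
  by_contra hinf
  obtain ⟨c, hc, hanti⟩ := exists_strictAnti homega hσ hπ hinf fun _ h => h.1
  have hc0 : P.Proper (c 0) :=
    ⟨fun h => hσ.zero_notMem (h ▸ (hc 0).1.1), fun h => (hc 0).1.2 (h ▸ hπ.1.star_zero_mem)⟩
  have hf' : P.Proper f := by
    refine ⟨hf, fun h => hc0.2 (le_antisymm ?_ (h ▸ (hc 0).2))⟩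
    exact le_star_comm (P.zero_le _)
  refine Set.infinite_range_of_injective hanti.injective ((hdisc f (c 0) hf' hc0).subset ?_)
  rintro _ ⟨n, rfl⟩
  exact ⟨(hc n).2, hanti.antitone n.zero_le⟩

/-- Flipping an ultrafilter so that it contains a consistent upper set. -/
theorem isUltra_flip {m U : Set H} (hm : P.IsUltra m) (hU : IsUpperSet U)
    (hcons : ∀ h ∈ U, P.star h ∉ U) : P.IsUltra (U ∪ {h ∈ m | P.star h ∉ U}) := by
  constructor
  · intro h
    have h1 := hm.1 h
    have h2 := hcons h
    simp only [Set.mem_union, Set.mem_ofPred_eq, P.star_star]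
    tauto
  · rintro h (hh | hh) k (hk | hk) hle
    · exact hcons k hk (hU hle hh)
    · exact hk.2 (hU hle hh)
    · exact hh.2 (hU (le_star_comm hle) hk)
    · exact hm.2 h hh.1 k hk.1 hle

theorem finite_image_star {S T : Set H} (hT : T.Finite) (h : ∀ a ∈ S, P.star a ∈ T) : S.Finite :=
  (hT.preimage P.star_injective.injOn).subset h

theorem IsAEClass.isUltra {Sg : Set (Set H)} (hSg : IsAEClass P Sg) {α : Set H} (hα : α ∈ Sg) :
    P.IsUltra α := by
  obtain ⟨_, _, rfl⟩ := hSg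
  exact hα.1

theorem IsAEClass.almostEq {Sg : Set (Set H)} (hSg : IsAEClass P Sg) {α β : Set H} (hα : α ∈ Sg)
    (hβ : β ∈ Sg) : AlmostEq α β := by
  obtain ⟨_, _, rfl⟩ := hSg
  exact hα.2.symm.trans hβ.2

theorem IsAEClass.mem {Sg : Set (Set H)} (hSg : IsAEClass P Sg) {α β : Set H} (hα : α ∈ Sg)
    (hβ : P.IsUltra β) (h : AlmostEq α β) : β ∈ Sg := by
  obtain ⟨_, _, rfl⟩ := hSg
  exact ⟨hβ, hα.2.trans h⟩

/-- The class of a median with a principal ultrafilter accumulates on the class of the second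
argument. -/
theorem subset_closure_of_med_mem (hdisc : P.IsDiscrete) (homega : P.OmegaDimensional)
    {Sg Sg1 : Set (Set H)} (hSg : IsAEClass P Sg) (hSg1 : IsAEClass P Sg1) {π σ α : Set H}
    (hπ : P.IsPrincipal π) (hσ : σ ∈ Sg) (hmed : med π σ α ∈ Sg1) :
    Sg ⊆ @closure _ (tychonoff H) Sg1 := by
  classical
  intro σ' hσ'
  rw [mem_closure_tychonoff_iff]
  intro F
  have hu := hSg.isUltra hσ
  have hu' := hSg.isUltra hσ'
  set m := med π σ α
  have hm := hSg1.isUltra hmed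
  let G : Finset H := (F ∪ F.image P.star).filter (· ∈ σ')
  let U : Set H := {h | ∃ g ∈ G, g ≤ h}
  have hGσ : ∀ g ∈ G, g ∈ σ' := fun g hg => (Finset.mem_filter.1 hg).2
  have hUσ : U ⊆ σ' := fun h ⟨g, hg, hle⟩ => hu'.mem_of_le (hGσ g hg) hle
  have hU : IsUpperSet U := fun a b hab ⟨g, hg, hle⟩ => ⟨g, hg, hle.trans hab⟩
  have hcons : ∀ h ∈ U, P.star h ∉ U := fun h hh hs => (hu'.1 h).1 (hUσ hh) (hUσ hs)
  have hfin : (U \ m).Finite := by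
    have h1 : (⋃ g ∈ G, {h ∈ σ \ π | g ≤ h}).Finite := by
      refine G.finite_toSet.biUnion fun g hg => finite_upper_diff hdisc homega hu hπ ?_
      rintro rfl
      exact hu'.zero_notMem (hGσ _ hg)
    refine (h1.union (hSg.almostEq hσ' hσ).1).subset ?_
    rintro h ⟨hhU, hhm⟩
    by_cases hhσ : h ∈ σ
    · obtain ⟨g, hg, hle⟩ := hhU
      refine Or.inl (Set.mem_biUnion (x := g) hg ⟨⟨hhσ, fun hhπ => hhm ?_⟩, hle⟩)
      exact Or.inl (Or.inl ⟨hhπ, hhσ⟩)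
    · exact Or.inr ⟨hUσ hhU, hhσ⟩
  have hτ := isUltra_flip hm hU hcons
  refine ⟨_, hSg1.mem hmed hτ ⟨?_, ?_⟩, ?_⟩
  · refine finite_image_star hfin (P := P) fun a ha => ⟨?_, (hm.1 a).1 ha.1⟩
    by_contra hs
    exact ha.2 (Or.inr ⟨ha.1, hs⟩)
  · refine hfin.subset ?_
    rintro a ⟨ha | ha, hn⟩
    · exact ⟨ha, hn⟩
    · exact absurd ha.1 hn
  · intro h hF
    have hGU : ∀ g ∈ G, g ∈ U := fun g hg => ⟨g, hg, le_rfl⟩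
    by_cases hh : h ∈ σ'
    · exact iff_of_true (Or.inl (hGU h (by simp [G, hF, hh]))) hh
    · refine iff_of_false ((hτ.1 h).not.2 (not_not.2 (Or.inl (hGU _ ?_)))) hh
      exact Finset.mem_filter.2
        ⟨Finset.mem_union_right _ (Finset.mem_image_of_mem _ hF), hu'.star_mem hh⟩

/-- If the class of `σ₁` accumulates at `σ`, then `σ₁` lies, up to finite error, between a
principal ultrafilter and `σ`. -/
theorem almostEq_med_of_mem_closure (homega : P.OmegaDimensional) {Sg1 : Set (Set H)}
    (hSg1 : IsAEClass P Sg1) {π σ σ1 : Set H} (hπ : P.IsPrincipal π) (hσ : P.IsUltra σ)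
    (hσ1 : σ1 ∈ Sg1) (hcl : σ ∈ @closure _ (tychonoff H) Sg1) :
    AlmostEq (med π σ σ1) σ1 := by
  have hu1 := hSg1.isUltra hσ1
  have hfin : (σ1 \ (π ∪ σ)).Finite := by
    by_contra hinf
    obtain ⟨c, hc, hanti⟩ := exists_strictAnti homega hu1 hπ hinf
      fun h hh => ⟨hh.1, fun hp => hh.2 (Or.inl hp)⟩
    obtain ⟨τ, hτ, hag⟩ := mem_closure_tychonoff_iff.1 hcl {c 0}
    have h0 : c 0 ∉ τ := fun h =>
      (hc 0).2 (Or.inr ((hag _ (Finset.mem_singleton_self _)).1 h))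
    have huτ := hSg1.isUltra hτ
    refine Set.infinite_range_of_injective hanti.injective
      ((hSg1.almostEq hσ1 hτ).1.subset ?_)
    rintro _ ⟨n, rfl⟩
    exact ⟨(hc n).1, fun h => h0 (huτ.mem_of_le h (hanti.antitone n.zero_le))⟩
  constructor
  · refine finite_image_star hfin (P := P) ?_
    rintro a ⟨(ha | ha) | ha, hn⟩
    · refine ⟨hu1.star_mem hn, ?_⟩
      rintro (h | h)
      · exact (hπ.1.1 a).1 ha.1 h
      · exact (hσ.1 a).1 ha.2 h
    · exact absurd ha.2 hn
    · exact absurd ha.2 hn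
  · refine hfin.subset fun a ha => ⟨ha.1, ?_⟩
    rintro (h | h)
    · exact ha.2 (Or.inr ⟨h, ha.1⟩)
    · exact ha.2 (Or.inl (Or.inr ⟨h, ha.1⟩))

end PocSet

theorem stmt15 {H : Type u} [PartialOrder H] (P : PocSet H)
    (hdisc : P.IsDiscrete) (homega : P.OmegaDimensional)
    (Sg : Set (Set H)) (hSg : IsAEClass P Sg) :
    (letI : TopologicalSpace (Set H) := tychonoff H
     (∀ π σ α : Set H, P.IsPrincipal π → σ ∈ Sg → P.IsUltra α →
        ∀ Sg1 : Set (Set H), IsAEClass P Sg1 → med π σ α ∈ Sg1 →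
          Sg ⊆ closure Sg1) ∧
     (∀ Sg1 : Set (Set H), IsAEClass P Sg1 → Sg ⊆ closure Sg1 →
        ∀ σ1 ∈ Sg1, ∀ σ ∈ Sg, ∀ π : Set H, P.IsPrincipal π →
          AlmostEq (med π σ σ1) σ1)) := by
  exact ⟨fun _ _ _ hπ hσ _ _ hSg1 hmed =>
      subset_closure_of_med_mem hdisc homega hSg hSg1 hπ hσ hmed,
    fun _ hSg1 hcl _ hσ1 _ hσ _ hπ =>
      almostEq_med_of_mem_closure homega hSg1 hπ (hSg.isUltra hσ) hσ1 (hcl hσ)⟩
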